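/- Let G_8 be the subgroup of GL_2(ℂ) generated by σ_1 = ((1−i)/2)·[[1,−1],[1,1]] and σ_2 = [[−i,0],[0,1]], acting on the polynomial ring ℂ[x,y] by linear substitution f(x,y) ↦ f(ax+by, cx+dy) for [[a,b],[c,d]] ∈ G_8. Then the invariant ring ℂ[x,y]^{G_8} equals the subalgebra of ℂ[x,y] generated by the two polynomials W_8(x,y) = x^8 + 14x^4y^4 + y^8 and W_12(x,y) = x^{12} − 33x^8y^4 − 33x^4y^8 + y^{12}. -/

import Mathlib

open MvPolynomial Matrix

/-- The action of a `2×2` complex matrix `M = [[a,b],[c,d]]` on bivariate polynomials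
by linear substitution: `f^M(x,y) = f(ax+by, cx+dy)`. -/
noncomputable def matAct (M : Matrix (Fin 2) (Fin 2) ℂ)
    (f : MvPolynomial (Fin 2) ℂ) : MvPolynomial (Fin 2) ℂ :=
  MvPolynomial.aeval (fun i : Fin 2 => MvPolynomial.C (M i 0) * MvPolynomial.X 0
    + MvPolynomial.C (M i 1) * MvPolynomial.X 1) f

/-- `σ₁ = ((1-i)/2)·[[1,-1],[1,1]]`. -/
noncomputable def sigma1 : Matrix (Fin 2) (Fin 2) ℂ :=
  ((1 - Complex.I) / 2) • !![1, -1; 1, 1]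

/-- `σ₂ = [[-i,0],[0,1]]`. -/
noncomputable def sigma2 : Matrix (Fin 2) (Fin 2) ℂ :=
  !![-Complex.I, 0; 0, 1]

lemma sigma1_det_ne_zero : sigma1.det ≠ 0 := by
  have h : sigma1.det = ((1 - Complex.I) / 2) ^ 2 * 2 := by
    simp [sigma1, Matrix.det_smul, Matrix.det_fin_two_of]
    ring
  rw [h]
  have h1 : (1 - Complex.I) ≠ 0 := by
    intro h0
    have := congrArg Complex.re h0
    simp at this
  exact mul_ne_zero (pow_ne_zero _ (div_ne_zero h1 two_ne_zero)) two_ne_zero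

lemma sigma2_det_ne_zero : sigma2.det ≠ 0 := by
  simp [sigma2, Matrix.det_fin_two_of]

/-- `σ₁` as an element of `GL₂(ℂ)`. -/
noncomputable def sigma1U : GL (Fin 2) ℂ :=
  Matrix.GeneralLinearGroup.mkOfDetNeZero sigma1 sigma1_det_ne_zero

/-- `σ₂` as an element of `GL₂(ℂ)`. -/
noncomputable def sigma2U : GL (Fin 2) ℂ :=
  Matrix.GeneralLinearGroup.mkOfDetNeZero sigma2 sigma2_det_ne_zero

/-- The subgroup `G₈ ≤ GL₂(ℂ)` generated by `σ₁` and `σ₂`. -/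
noncomputable def G8 : Subgroup (GL (Fin 2) ℂ) :=
  Subgroup.closure {sigma1U, sigma2U}

/-- `W₈(x,y) = x⁸ + 14x⁴y⁴ + y⁸`. -/
noncomputable def W8 : MvPolynomial (Fin 2) ℂ :=
  X 0 ^ 8 + 14 * X 0 ^ 4 * X 1 ^ 4 + X 1 ^ 8

/-- `W₁₂(x,y) = x¹² − 33x⁸y⁴ − 33x⁴y⁸ + y¹²`. -/
noncomputable def W12 : MvPolynomial (Fin 2) ℂ :=
  X 0 ^ 12 - 33 * X 0 ^ 8 * X 1 ^ 4 - 33 * X 0 ^ 4 * X 1 ^ 8 + X 1 ^ 12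


noncomputable def act8 (M : Matrix (Fin 2) (Fin 2) ℂ) :
    MvPolynomial (Fin 2) ℂ →ₐ[ℂ] MvPolynomial (Fin 2) ℂ :=
  MvPolynomial.aeval (fun i : Fin 2 => MvPolynomial.C (M i 0) * MvPolynomial.X 0
    + MvPolynomial.C (M i 1) * MvPolynomial.X 1)

lemma act8_X (M : Matrix (Fin 2) (Fin 2) ℂ) (i : Fin 2) :
    act8 M (X i) = C (M i 0) * X 0 + C (M i 1) * X 1 := by
  simp [act8]

lemma act8_C (M : Matrix (Fin 2) (Fin 2) ℂ) (c : ℂ) : act8 M (C c) = C c := by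
  simp [act8]

lemma act8_mul (M N : Matrix (Fin 2) (Fin 2) ℂ) (f : MvPolynomial (Fin 2) ℂ) :
    act8 (M * N) f = act8 N (act8 M f) := by
  have : act8 (M * N) = (act8 N).comp (act8 M) := by
    apply MvPolynomial.algHom_ext
    intro i
    simp only [AlgHom.comp_apply, act8_X, map_add, map_mul, act8_C, Matrix.mul_apply,
      Fin.sum_univ_two]
    ring
  rw [this]; rfl

lemma act8_one (f : MvPolynomial (Fin 2) ℂ) : act8 1 f = f := by
  have : act8 1 = AlgHom.id ℂ _ := by
    apply MvPolynomial.algHom_ext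
    intro i
    fin_cases i <;> simp [act8_X]
  rw [this]; rfl

lemma act8_homog (M : Matrix (Fin 2) (Fin 2) ℂ) {f : MvPolynomial (Fin 2) ℂ} {n : ℕ}
    (hf : f.IsHomogeneous n) : (act8 M f).IsHomogeneous n := by
  have := hf.aeval (n := 1) (fun i : Fin 2 => (MvPolynomial.C (M i 0) * MvPolynomial.X 0
    + MvPolynomial.C (M i 1) * MvPolynomial.X 1 : MvPolynomial (Fin 2) ℂ)) (fun i =>
      (isHomogeneous_C_mul_X _ _).add (isHomogeneous_C_mul_X _ _))
  simpa [act8] using this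

lemma act8_comp (M : Matrix (Fin 2) (Fin 2) ℂ) (f : MvPolynomial (Fin 2) ℂ) (n : ℕ) :
    homogeneousComponent n (act8 M f) = act8 M (homogeneousComponent n f) := by
  conv_lhs => rw [← sum_homogeneousComponent f]
  rw [map_sum, map_sum]
  rw [Finset.sum_congr rfl (fun i _ => homogeneousComponent_of_mem (m := n)
    (act8_homog M (homogeneousComponent_isHomogeneous i f)))]
  simp only [Finset.sum_ite_eq, Finset.mem_range]
  split_ifs with h
  · rfl
  · rw [homogeneousComponent_eq_zero _ _ (by omega), map_zero]

lemma comp_mul8 {p : MvPolynomial (Fin 2) ℂ} {m : ℕ} (hp : p.IsHomogeneous m)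
    (g : MvPolynomial (Fin 2) ℂ) (k : ℕ) :
    homogeneousComponent (m + k) (p * g) = p * homogeneousComponent k g := by
  conv_lhs => rw [← sum_homogeneousComponent g]
  rw [Finset.mul_sum, map_sum]
  rw [Finset.sum_congr rfl (fun i _ => homogeneousComponent_of_mem (m := m + k)
    (hp.mul (homogeneousComponent_isHomogeneous i g)))]
  simp only [add_right_inj, Finset.sum_ite_eq, Finset.mem_range]
  split_ifs with h
  · rfl
  · rw [homogeneousComponent_eq_zero _ _ (by omega), mul_zero]

lemma act8_diag_coeff (a b : ℂ) (f : MvPolynomial (Fin 2) ℂ) (m : Fin 2 →₀ ℕ) :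
    coeff m (act8 !![a, 0; 0, b] f) = a ^ m 0 * b ^ m 1 * coeff m f := by
  induction f using MvPolynomial.induction_on' with
  | add p q hp hq => rw [map_add, coeff_add, hp, hq, coeff_add]; ring
  | monomial u c =>
    have : act8 !![a, 0; 0, b] (monomial u c) = monomial u (a ^ u 0 * b ^ u 1 * c) := by
      rw [monomial_eq, monomial_eq, Finsupp.prod_fintype _ _ (by simp),
        Fin.prod_univ_two]
      simp only [map_mul, map_pow, act8_C, act8_X]
      simp
      ring
    rw [this, coeff_monomial, coeff_monomial]
    split_ifs with h
    · rw [h]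
    · simp

lemma I_pow8 (n : ℕ) (h : (-Complex.I) ^ n = 1) : 4 ∣ n := by
  have h4 : (-Complex.I) ^ 4 = 1 := by
    have := Complex.I_sq
    linear_combination (Complex.I ^ 2 - 1) * this
  rw [← Nat.div_add_mod n 4, pow_add, pow_mul, h4, one_pow, one_mul] at h
  have hlt := Nat.mod_lt n (show 4 > 0 by norm_num)
  rw [Nat.dvd_iff_mod_eq_zero]
  interval_cases n % 4
  · rfl
  · have := congrArg Complex.re h; simp at this
  · have := congrArg Complex.re h; norm_num at this
  · exfalso
    have h3 : (-Complex.I) ^ 3 = Complex.I := by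
      have := Complex.I_sq
      linear_combination (-Complex.I) * this
    rw [h3] at h
    have := congrArg Complex.re h; simp at this

def Inv8 (f : MvPolynomial (Fin 2) ℂ) : Prop := act8 sigma1 f = f ∧ act8 sigma2 f = f

lemma I2 : (C Complex.I : MvPolynomial (Fin 2) ℂ) ^ 2 = -1 := by
  rw [← C_pow, Complex.I_sq]; simp

lemma act8_s1_0 : act8 sigma1 (X 0) = C ((1 - Complex.I) / 2) * (X 0 - X 1) := by
  rw [act8_X]; simp [sigma1]; ring

lemma act8_s1_1 : act8 sigma1 (X 1) = C ((1 - Complex.I) / 2) * (X 0 + X 1) := by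
  rw [act8_X]; simp [sigma1]; ring

lemma act8_s2_0 : act8 sigma2 (X 0) = - C Complex.I * X 0 := by
  rw [act8_X]; simp [sigma2]

lemma act8_s2_1 : act8 sigma2 (X 1) = X 1 := by
  rw [act8_X]; simp [sigma2]

lemma c4 : ((1 - Complex.I) / 2) ^ 4 = - 1 / 4 := by
  have := Complex.I_sq
  linear_combination (1 / 16 * (Complex.I ^ 2 - 4 * Complex.I + 5)) * this

lemma cC8 : (C ((1 - Complex.I) / 2) : MvPolynomial (Fin 2) ℂ) ^ 8 = C (1 / 16) := by
  rw [← C_pow]; congr 1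
  linear_combination (((1 - Complex.I) / 2) ^ 4 - 1 / 4) * c4

lemma cC12 : (C ((1 - Complex.I) / 2) : MvPolynomial (Fin 2) ℂ) ^ 12 = C (-1 / 64) := by
  rw [← C_pow]; congr 1
  have : ((1 - Complex.I) / 2) ^ 12 = (((1 - Complex.I) / 2) ^ 4) ^ 3 := by ring
  rw [this, c4]; norm_num

lemma C16 : (C (1 / 16) : MvPolynomial (Fin 2) ℂ) * 16 = 1 := by
  have : (16 : MvPolynomial (Fin 2) ℂ) = C 16 := (map_ofNat C 16).symm
  rw [this, ← C_mul]; norm_num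

lemma C64 : (C (-1 / 64) : MvPolynomial (Fin 2) ℂ) * 64 = -1 := by
  have : (64 : MvPolynomial (Fin 2) ℂ) = C 64 := (map_ofNat C 64).symm
  rw [this, ← C_mul]; norm_num

lemma inv_W8 : Inv8 W8 := by
  constructor
  · simp only [W8, map_add, map_mul, map_pow, act8_s1_0, act8_s1_1, map_ofNat]
    linear_combination ((X 0 - X 1) ^ 8 + 14 * (X 0 - X 1) ^ 4 * (X 0 + X 1) ^ 4
      + (X 0 + X 1) ^ 8) * cC8 + (X 0 ^ 8 + 14 * X 0 ^ 4 * X 1 ^ 4 + X 1 ^ 8) * C16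
  · simp only [W8, map_add, map_mul, map_pow, act8_s2_0, act8_s2_1, map_ofNat]
    have h4 : (C Complex.I : MvPolynomial (Fin 2) ℂ) ^ 4 = 1 := by
      linear_combination (C Complex.I ^ 2 - 1) * I2
    linear_combination (X 0 ^ 8 * (C Complex.I ^ 4 + 1) + 14 * X 0 ^ 4 * X 1 ^ 4) * h4

lemma inv_W12 : Inv8 W12 := by
  constructor
  · simp only [W12, map_add, map_sub, map_mul, map_pow, act8_s1_0, act8_s1_1, map_ofNat]
    linear_combination ((X 0 - X 1) ^ 12 - 33 * (X 0 - X 1) ^ 8 * (X 0 + X 1) ^ 4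
      - 33 * (X 0 - X 1) ^ 4 * (X 0 + X 1) ^ 8
      + (X 0 + X 1) ^ 12) * cC12 - (X 0 ^ 12 - 33 * X 0 ^ 8 * X 1 ^ 4
       - 33 * X 0 ^ 4 * X 1 ^ 8 + X 1 ^ 12) * C64
  · simp only [W12, map_add, map_sub, map_mul, map_pow, act8_s2_0, act8_s2_1, map_ofNat]
    have h4 : (C Complex.I : MvPolynomial (Fin 2) ℂ) ^ 4 = 1 := by
      linear_combination (C Complex.I ^ 2 - 1) * I2
    linear_combination (X 0 ^ 12 * (C Complex.I ^ 8 + C Complex.I ^ 4 + 1)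
      - 33 * X 0 ^ 8 * X 1 ^ 4 * (C Complex.I ^ 4 + 1) - 33 * X 0 ^ 4 * X 1 ^ 8) * h4

/-- the invariants as a subalgebra -/
noncomputable def invAlg8 : Subalgebra ℂ (MvPolynomial (Fin 2) ℂ) :=
  AlgHom.equalizer (act8 sigma1) (AlgHom.id ℂ _) ⊓ AlgHom.equalizer (act8 sigma2) (AlgHom.id ℂ _)

lemma mem_invAlg8 (f) : f ∈ invAlg8 ↔ Inv8 f := by
  simp [invAlg8, Inv8, AlgHom.mem_equalizer]

lemma adjoin_le8 : Algebra.adjoin ℂ ({W8, W12} : Set (MvPolynomial (Fin 2) ℂ)) ≤ invAlg8 := by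
  apply Algebra.adjoin_le
  rintro f (rfl | rfl)
  · exact (mem_invAlg8 _).2 inv_W8
  · exact (mem_invAlg8 _).2 inv_W12

lemma inv_all8 (f : MvPolynomial (Fin 2) ℂ) (hf : Inv8 f) :
    ∀ M ∈ G8, act8 (M : Matrix (Fin 2) (Fin 2) ℂ) f = f := by
  intro M hM
  induction hM using Subgroup.closure_induction with
  | mem x hx =>
    rcases hx with rfl | rfl
    · exact hf.1
    · exact hf.2
  | one => exact act8_one f
  | mul x y _ _ hx hy => rw [Units.val_mul, act8_mul, hx, hy]
  | inv x _ hx =>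
    conv_lhs => rw [← hx]
    rw [← act8_mul, ← Units.val_mul, mul_inv_cancel, Units.val_one, act8_one]

lemma exps8 {f : MvPolynomial (Fin 2) ℂ} (hf : Inv8 f) {m : Fin 2 →₀ ℕ} (hm : coeff m f ≠ 0) :
    4 ∣ m 0 ∧ 4 ∣ m 1 := by
  constructor
  · have h := act8_diag_coeff (-Complex.I) 1 f m
    have h2 : act8 !![-Complex.I, 0; 0, 1] f = f := hf.2
    rw [h2] at h
    apply I_pow8
    apply mul_right_cancel₀ hm
    rw [one_mul]; simpa using h.symm
  · have h := act8_diag_coeff 1 (-Complex.I) f m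
    have h2 : act8 !![1, 0; 0, -Complex.I] f = f := by
      have : (!![1, 0; 0, -Complex.I] : Matrix (Fin 2) (Fin 2) ℂ)
          = sigma1 * (sigma1 * (sigma2 * (sigma1 * sigma1))) := by
        have hI := Complex.I_sq
        have hI3 : Complex.I ^ 3 = - Complex.I := by linear_combination Complex.I * hI
        have hI4 : Complex.I ^ 4 = 1 := by linear_combination (Complex.I ^ 2 - 1) * hI
        have hI5 : Complex.I ^ 5 = Complex.I := by linear_combination Complex.I * hI4
        ext i j
        fin_cases i <;> fin_cases j <;>
          simp [sigma1, sigma2, Matrix.mul_apply, Fin.sum_univ_two] <;> ring_nf <;>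
          simp only [hI, hI3, hI4, hI5] <;> ring
      rw [this]
      simp only [act8_mul, hf.1, hf.2]
    rw [h2] at h
    apply I_pow8
    apply mul_right_cancel₀ hm
    rw [one_mul]; simpa using h.symm

lemma degree_fin2 (m : Fin 2 →₀ ℕ) : m.degree = m 0 + m 1 := by
  rw [Finsupp.degree_eq_sum, Fin.sum_univ_two]

lemma X4_dvd {f : MvPolynomial (Fin 2) ℂ} (hf : Inv8 f) {d : ℕ} (hd : f.IsHomogeneous d)
    (h0 : coeff (Finsupp.single 0 d) f = 0) : (X 1 : MvPolynomial (Fin 2) ℂ) ^ 4 ∣ f := by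
  rw [f.as_sum]
  apply Finset.dvd_sum
  intro m hm
  rw [mem_support_iff] at hm
  have h4 := (exps8 hf hm).2
  have hdeg : m.degree = d := by
    by_contra h
    exact hm (hd.coeff_eq_zero h)
  rw [degree_fin2] at hdeg
  have h1 : m 1 ≠ 0 := by
    intro h1
    apply hm
    have : m = Finsupp.single 0 d := by
      ext i; fin_cases i <;> simp [h1]; omega
    rw [this, h0]
  rw [monomial_eq, Finsupp.prod_fintype _ _ (by simp), Fin.prod_univ_two]
  exact ((pow_dvd_pow _ (by omega)).mul_left _).mul_left _

lemma deg4_8 {f : MvPolynomial (Fin 2) ℂ} (hf : Inv8 f) (hd : f.IsHomogeneous 4) : f = 0 := by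
  set a := coeff (Finsupp.single 0 4) f with ha
  set b := coeff (Finsupp.single 1 4) f with hb
  have hfe : f = C a * X 0 ^ 4 + C b * X 1 ^ 4 := by
    ext m
    rw [coeff_add, coeff_C_mul, coeff_C_mul, coeff_X_pow, coeff_X_pow]
    by_cases hm : coeff m f = 0
    · rw [hm]
      split_ifs with h1 h2 h2
      · rw [← h1, Finsupp.single_left_inj (by norm_num)] at h2; simp at h2
      · rw [ha, h1, hm]; simp
      · rw [hb, h2, hm]; simp
      · simp
    · have h4 := exps8 hf hm
      have hdeg : m.degree = 4 := by
        by_contra h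
        exact hm (hd.coeff_eq_zero h)
      rw [degree_fin2] at hdeg
      obtain ⟨⟨u, hu⟩, ⟨v, hv⟩⟩ := h4
      have : (u = 0 ∧ v = 1) ∨ (u = 1 ∧ v = 0) := by omega
      rcases this with ⟨rfl, rfl⟩ | ⟨rfl, rfl⟩
      · have : m = Finsupp.single 1 4 := by
          ext i; fin_cases i <;> simp [hu, hv]
        rw [this, if_neg, if_pos rfl, ← hb]; simp
        rw [Finsupp.single_left_inj (by norm_num)]; simp
      · have : m = Finsupp.single 0 4 := by
          ext i; fin_cases i <;> simp [hu, hv]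
        rw [this, if_pos rfl, if_neg, ← ha]; simp
        rw [Finsupp.single_left_inj (by norm_num)]; simp
  have h1 := hf.1
  rw [hfe] at h1
  simp only [map_add, map_mul, map_pow, act8_C, act8_s1_0, act8_s1_1] at h1
  have e1 := congrArg (MvPolynomial.eval ![1, 0]) h1
  have e2 := congrArg (MvPolynomial.eval ![0, 1]) h1
  simp only [map_add, map_sub, map_mul, map_pow, eval_C, eval_X] at e1 e2
  simp only [mul_pow, c4] at e1 e2
  norm_num at e1 e2
  have ha0 : a = 0 := by linear_combination (-5/6 : ℂ) * e1 + (1/6 : ℂ) * e2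
  have hb0 : b = 0 := by linear_combination e1 - e2 + ha0
  rw [hfe, ha0, hb0]; simp

lemma relprime_XX : IsRelPrime (X 0 : MvPolynomial (Fin 2) ℂ) (X 1) := by
  have : Irreducible (X 0 : MvPolynomial (Fin 2) ℂ) := X_prime.irreducible
  rw [this.isRelPrime_iff_not_dvd]
  rintro ⟨g, hg⟩
  have := congrArg (MvPolynomial.eval ![0, 1]) hg
  simp at this

lemma relprime_lin {p q : MvPolynomial (Fin 2) ℂ} (A B A' B' : MvPolynomial (Fin 2) ℂ)
    (h0 : A * p + B * q = X 0) (h1 : A' * p + B' * q = X 1) : IsRelPrime p q := by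
  intro d hp hq
  apply relprime_XX
  · rw [← h0]; exact (hp.mul_left _).add (hq.mul_left _)
  · rw [← h1]; exact (hp.mul_left _).add (hq.mul_left _)

noncomputable def Del8 : MvPolynomial (Fin 2) ℂ :=
  X 1 ^ 4 * X 0 ^ 4 * (X 0 + X 1) ^ 4 * (X 0 - X 1) ^ 4 * (X 0 + C Complex.I * X 1) ^ 4
    * (X 0 - C Complex.I * X 1) ^ 4

lemma Del8_eq : 108 * Del8 = W8 ^ 3 - W12 ^ 2 := by
  have : Del8 = (X 0 * X 1 * (X 0 ^ 4 - X 1 ^ 4)) ^ 4 := by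
    have h : (X 0 + C Complex.I * X 1) * (X 0 - C Complex.I * X 1)
      = (X 0 ^ 2 + X 1 ^ 2 : MvPolynomial (Fin 2) ℂ) := by
      linear_combination (-X 1 ^ 2) * I2
    have h2 : (X 0 ^ 4 - X 1 ^ 4 : MvPolynomial (Fin 2) ℂ) = (X 0 + X 1) * (X 0 - X 1) *
       ((X 0 + C Complex.I * X 1) * (X 0 - C Complex.I * X 1)) := by rw [h]; ring
    rw [h2, Del8]; ring
  rw [this, W8, W12]; ring

lemma Del8_mem : Del8 ∈ Algebra.adjoin ℂ ({W8, W12} : Set (MvPolynomial (Fin 2) ℂ)) := by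
  have h : Del8 = C (1 / 108) * (W8 ^ 3 - W12 ^ 2) := by
    rw [← Del8_eq]
    have : (108 : MvPolynomial (Fin 2) ℂ) = C 108 := (map_ofNat C 108).symm
    rw [this, ← mul_assoc, ← C_mul]; norm_num
  rw [h]
  have h8 : W8 ∈ Algebra.adjoin ℂ ({W8, W12} : Set (MvPolynomial (Fin 2) ℂ)) :=
    Algebra.subset_adjoin (by simp)
  have h12 : W12 ∈ Algebra.adjoin ℂ ({W8, W12} : Set (MvPolynomial (Fin 2) ℂ)) :=
    Algebra.subset_adjoin (by simp)
  exact mul_mem (Subalgebra.algebraMap_mem _ _) (sub_mem (pow_mem h8 _) (pow_mem h12 _))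

lemma lin_homog (a b : ℂ) : (C a * X 0 + C b * X 1 : MvPolynomial (Fin 2) ℂ).IsHomogeneous 1 :=
  (isHomogeneous_C_mul_X _ _).add (isHomogeneous_C_mul_X _ _)

lemma Del8_homog : Del8.IsHomogeneous 24 := by
  have h1 := lin_homog 1 1
  have h2 := lin_homog 1 (-1)
  have h3 := lin_homog 1 Complex.I
  have h4 := lin_homog 1 (-Complex.I)
  simp only [C_1, one_mul, C_neg, neg_mul, ← sub_eq_add_neg] at h1 h2 h3 h4
  exact ((((((isHomogeneous_X_pow 1 4).mul (isHomogeneous_X_pow 0 4)).mul (h1.pow 4)).mul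
    (h2.pow 4)).mul (h3.pow 4)).mul (h4.pow 4))

lemma Del8_ne : Del8 ≠ 0 := by
  intro h
  have := Del8_eq
  rw [h] at this
  have := congrArg (MvPolynomial.eval ![2, 1]) this
  simp [W8, W12] at this
  norm_num at this

lemma six_dvd8 {a b c d e g f : MvPolynomial (Fin 2) ℂ}
    (ha : a ^ 4 ∣ f) (hb : b ^ 4 ∣ f) (hc : c ^ 4 ∣ f) (hd : d ^ 4 ∣ f) (he : e ^ 4 ∣ f)
    (hg : g ^ 4 ∣ f)
    (ab : IsRelPrime a b) (ac : IsRelPrime a c) (ad : IsRelPrime a d) (ae : IsRelPrime a e)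
    (ag : IsRelPrime a g) (bc : IsRelPrime b c) (bd : IsRelPrime b d) (be : IsRelPrime b e)
    (bg : IsRelPrime b g) (cd : IsRelPrime c d) (ce : IsRelPrime c e) (cg : IsRelPrime c g)
    (de : IsRelPrime d e) (dg : IsRelPrime d g) (eg : IsRelPrime e g) :
    a ^ 4 * b ^ 4 * c ^ 4 * d ^ 4 * e ^ 4 * g ^ 4 ∣ f := by
  have P : ∀ {p q : MvPolynomial (Fin 2) ℂ}, IsRelPrime p q → IsRelPrime (p ^ 4) (q ^ 4) :=
    fun h => h.pow
  have h1 := (P ab).mul_dvd ha hb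
  have h2 := ((P ac).mul_left (P bc)).mul_dvd h1 hc
  have h3 := (((P ad).mul_left (P bd)).mul_left (P cd)).mul_dvd h2 hd
  have h4 := ((((P ae).mul_left (P be)).mul_left (P ce)).mul_left (P de)).mul_dvd h3 he
  exact (((((P ag).mul_left (P bg)).mul_left (P cg)).mul_left (P dg)).mul_left (P eg)).mul_dvd h4 hg

lemma Del8_dvd {f : MvPolynomial (Fin 2) ℂ} (hf : Inv8 f)
    (h : (X 1 : MvPolynomial (Fin 2) ℂ) ^ 4 ∣ f) : Del8 ∣ f := by
  have s1 : ∀ {p : MvPolynomial (Fin 2) ℂ}, p ^ 4 ∣ f → (act8 sigma1 p) ^ 4 ∣ f := by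
    intro p hp
    have := map_dvd (act8 sigma1) hp
    rwa [map_pow, hf.1] at this
  have s2 : ∀ {p : MvPolynomial (Fin 2) ℂ}, p ^ 4 ∣ f → (act8 sigma2 p) ^ 4 ∣ f := by
    intro p hp
    have := map_dvd (act8 sigma2) hp
    rwa [map_pow, hf.2] at this
  have dd : ∀ {p q : MvPolynomial (Fin 2) ℂ}, q ^ 4 ∣ f → p ∣ q → p ^ 4 ∣ f :=
    fun h1 h2 => (pow_dvd_pow_of_dvd h2 4).trans h1
  have hp : (X 0 + X 1 : MvPolynomial (Fin 2) ℂ) ^ 4 ∣ f := by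
    apply dd (s1 h); rw [act8_s1_1]; exact dvd_mul_left _ _
  have hx : (X 0 : MvPolynomial (Fin 2) ℂ) ^ 4 ∣ f := by
    apply dd (s1 hp); rw [map_add, act8_s1_0, act8_s1_1]
    exact ⟨C ((1 - Complex.I) / 2) * 2, by ring⟩
  have hi : (X 0 + C Complex.I * X 1 : MvPolynomial (Fin 2) ℂ) ^ 4 ∣ f := by
    apply dd (s2 hp); rw [map_add, act8_s2_0, act8_s2_1]
    exact ⟨- C Complex.I, by linear_combination X 1 * I2⟩
  have hm : (X 0 - X 1 : MvPolynomial (Fin 2) ℂ) ^ 4 ∣ f := by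
    apply dd (s2 hi); rw [map_add, map_mul, act8_C, act8_s2_0, act8_s2_1]
    exact ⟨- C Complex.I, by ring⟩
  have hj : (X 0 - C Complex.I * X 1 : MvPolynomial (Fin 2) ℂ) ^ 4 ∣ f := by
    apply dd (s2 hm); rw [map_sub, act8_s2_0, act8_s2_1]
    exact ⟨- C Complex.I, by linear_combination (-X 1) * I2⟩
  -- coprimality
  have key : ∀ a b : ℂ, a ≠ b → IsRelPrime (X 0 + C a * X 1 : MvPolynomial (Fin 2) ℂ)
      (X 0 + C b * X 1) := by
    intro a b hab
    have hab' : a - b ≠ 0 := sub_ne_zero.2 hab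
    have e : (C (1 / (a - b)) : MvPolynomial (Fin 2) ℂ) * (C a - C b) = 1 := by
      rw [← C_sub, ← C_mul, one_div, inv_mul_cancel₀ hab', C_1]
    refine relprime_lin (- C (1 / (a - b)) * C b) (C (1 / (a - b)) * C a)
      (C (1 / (a - b))) (- C (1 / (a - b))) ?_ ?_
    · linear_combination X 0 * e
    · linear_combination X 1 * e
  have keyx : ∀ a : ℂ, IsRelPrime (X 1) (X 0 + C a * X 1 : MvPolynomial (Fin 2) ℂ) := by
    intro a
    exact relprime_lin (-C a) 1 1 0 (by ring) (by ring)
  have f0 : (X 0 : MvPolynomial (Fin 2) ℂ) = X 0 + C 0 * X 1 := by simp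
  have f1 : (X 0 + X 1 : MvPolynomial (Fin 2) ℂ) = X 0 + C 1 * X 1 := by simp
  have f2 : (X 0 - X 1 : MvPolynomial (Fin 2) ℂ) = X 0 + C (-1) * X 1 := by simp; ring
  have f3 : (X 0 - C Complex.I * X 1 : MvPolynomial (Fin 2) ℂ) = X 0 + C (-Complex.I) * X 1 := by
    simp; ring
  have n1 : (0 : ℂ) ≠ Complex.I := fun h => by simpa using congrArg Complex.im h
  have n2 : (0 : ℂ) ≠ -Complex.I := fun h => by simpa using congrArg Complex.im h
  have n3 : (1 : ℂ) ≠ Complex.I := fun h => by simpa using congrArg Complex.im h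
  have n4 : (1 : ℂ) ≠ -Complex.I := fun h => by simpa using congrArg Complex.im h
  have n5 : (-1 : ℂ) ≠ Complex.I := fun h => by simpa using congrArg Complex.im h
  have n6 : (-1 : ℂ) ≠ -Complex.I := fun h => by simpa using congrArg Complex.im h
  have n7 : Complex.I ≠ -Complex.I := fun h => by
    have := congrArg Complex.im h; norm_num at this
  have n8 : (1 : ℂ) ≠ -1 := by norm_num
  have keyx0 := keyx 0
  have key0 := key 0
  rw [← f0] at keyx0
  simp only [← f0] at key0
  have k1 := key0 1 (by norm_num)
  have k2 := key0 (-1) (by norm_num)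
  have k3 := key0 _ n1
  have k4 := key0 _ n2
  have k5 := keyx 1
  have k6 := keyx (-1)
  have k7 := keyx Complex.I
  have k8 := keyx (-Complex.I)
  have k9 := key _ _ n8
  have k10 := key _ _ n3
  have k11 := key _ _ n4
  have k12 := key _ _ n5
  have k13 := key _ _ n6
  have k14 := key _ _ n7
  rw [← f1] at k1 k5 k9 k10 k11
  rw [← f2] at k2 k6 k9 k12 k13
  rw [← f3] at k4 k8 k11 k13 k14
  exact six_dvd8 h hx hp hm hi hj keyx0 k5 k6 k7 k8 k1 k2 k3 k4 k9 k10 k11 k12 k13 k14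

lemma W8_homog : W8.IsHomogeneous 8 := by
  have h : (14 * X 0 ^ 4 * X 1 ^ 4 : MvPolynomial (Fin 2) ℂ).IsHomogeneous (0 + 4 + 4) :=
    (((isHomogeneous_C (Fin 2) (14 : ℂ))).mul (isHomogeneous_X_pow 0 4)).mul
      (isHomogeneous_X_pow 1 4)
  exact ((isHomogeneous_X_pow 0 8).add h).add (isHomogeneous_X_pow 1 8)

lemma W12_homog : W12.IsHomogeneous 12 := by
  have h : (33 * X 0 ^ 8 * X 1 ^ 4 : MvPolynomial (Fin 2) ℂ).IsHomogeneous (0 + 8 + 4) :=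
    (((isHomogeneous_C (Fin 2) (33 : ℂ))).mul (isHomogeneous_X_pow 0 8)).mul
      (isHomogeneous_X_pow 1 4)
  have h' : (33 * X 0 ^ 4 * X 1 ^ 8 : MvPolynomial (Fin 2) ℂ).IsHomogeneous (0 + 4 + 8) :=
    (((isHomogeneous_C (Fin 2) (33 : ℂ))).mul (isHomogeneous_X_pow 0 4)).mul
      (isHomogeneous_X_pow 1 8)
  exact (((isHomogeneous_X_pow 0 12).sub h).sub h').add (isHomogeneous_X_pow 1 12)

/-- for homogeneous polynomials the leading coefficient is evaluation at (1,0) -/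
lemma coeff_eq_eval8 {f : MvPolynomial (Fin 2) ℂ} {d : ℕ} (hd : f.IsHomogeneous d) :
    coeff (Finsupp.single 0 d) f = MvPolynomial.eval ![1, 0] f := by
  rw [eval_eq']
  rw [Finset.sum_eq_single (Finsupp.single 0 d)]
  · simp [Fin.prod_univ_two]
  · intro m hm hne
    rw [mem_support_iff] at hm
    have hdeg : m.degree = d := by
      by_contra h
      exact hm (hd.coeff_eq_zero h)
    rw [degree_fin2] at hdeg
    have h1 : m 1 ≠ 0 := by
      intro h1
      apply hne
      ext i; fin_cases i <;> simp [h1]; omega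
    simp [Fin.prod_univ_two, h1]
  · intro h
    rw [notMem_support_iff.1 h]; simp

lemma main8 (d : ℕ) : ∀ f : MvPolynomial (Fin 2) ℂ, f.IsHomogeneous d → Inv8 f →
    f ∈ Algebra.adjoin ℂ ({W8, W12} : Set (MvPolynomial (Fin 2) ℂ)) := by
  induction d using Nat.strong_induction_on with
  | _ d ih =>
  intro f hd hf
  by_cases hf0 : f = 0
  · rw [hf0]; exact zero_mem _
  have h4 : 4 ∣ d := by
    obtain ⟨m, hm⟩ := MvPolynomial.ne_zero_iff.1 hf0
    have hdeg : m.degree = d := by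
      by_contra h
      exact hm (hd.coeff_eq_zero h)
    rw [degree_fin2] at hdeg
    rw [← hdeg]
    exact dvd_add (exps8 hf hm).1 (exps8 hf hm).2
  have hne4 : d ≠ 4 := by
    rintro rfl
    exact hf0 (deg4_8 hf hd)
  obtain ⟨a, b, hab⟩ : ∃ a b, d = 8 * a + 12 * b := by
    obtain ⟨k, rfl⟩ := h4
    rcases Nat.even_or_odd' k with ⟨j, rfl | rfl⟩
    · exact ⟨j, 0, by ring⟩
    · exact ⟨j - 1, 1, by omega⟩
  have h8 : W8 ∈ Algebra.adjoin ℂ ({W8, W12} : Set (MvPolynomial (Fin 2) ℂ)) :=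
    Algebra.subset_adjoin (by simp)
  have h12 : W12 ∈ Algebra.adjoin ℂ ({W8, W12} : Set (MvPolynomial (Fin 2) ℂ)) :=
    Algebra.subset_adjoin (by simp)
  set c := MvPolynomial.eval ![1, 0] f with hc
  set p : MvPolynomial (Fin 2) ℂ := C c * (W8 ^ a * W12 ^ b) with hp
  have hpm : p ∈ Algebra.adjoin ℂ ({W8, W12} : Set (MvPolynomial (Fin 2) ℂ)) :=
    mul_mem (Subalgebra.algebraMap_mem _ _) (mul_mem (pow_mem h8 _) (pow_mem h12 _))
  have hph : p.IsHomogeneous d := by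
    rw [hab]
    exact ((W8_homog.pow a).mul (W12_homog.pow b)).C_mul c
  have hpi := adjoin_le8 hpm
  set g := f - p with hg
  have hgi : Inv8 g := (mem_invAlg8 _).1 (sub_mem ((mem_invAlg8 _).2 hf) hpi)
  have hgh : g.IsHomogeneous d := hd.sub hph
  have hg0 : coeff (Finsupp.single 0 d) g = 0 := by
    rw [coeff_eq_eval8 hgh, hg, hp]
    simp [W8, W12, hc]
  suffices hgm : g ∈ Algebra.adjoin ℂ ({W8, W12} : Set (MvPolynomial (Fin 2) ℂ)) by
    have : f = g + p := by rw [hg]; ring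
    rw [this]; exact add_mem hgm hpm
  by_cases hgz : g = 0
  · rw [hgz]; exact zero_mem _
  obtain ⟨q, hq⟩ := Del8_dvd hgi (X4_dvd hgi hgh hg0)
  have hqz : q ≠ 0 := by rintro rfl; exact hgz (by rw [hq, mul_zero])
  have htd := totalDegree_mul_of_isDomain Del8_ne hqz
  rw [← hq, hgh.totalDegree hgz, Del8_homog.totalDegree Del8_ne] at htd
  have hqc : q = homogeneousComponent q.totalDegree q := by
    apply mul_left_cancel₀ Del8_ne
    rw [← comp_mul8 Del8_homog, ← htd, ← hq, homogeneousComponent_of_mem hgh, if_pos rfl]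
  have hqh : q.IsHomogeneous q.totalDegree := by
    have := homogeneousComponent_isHomogeneous q.totalDegree q
    rwa [← hqc] at this
  have hDi : Inv8 Del8 := (mem_invAlg8 _).1 (adjoin_le8 Del8_mem)
  have hqi : Inv8 q := by
    constructor
    · apply mul_left_cancel₀ Del8_ne
      have := hgi.1
      rwa [hq, map_mul, hDi.1] at this
    · apply mul_left_cancel₀ Del8_ne
      have := hgi.2
      rwa [hq, map_mul, hDi.2] at this
  rw [hq]
  exact mul_mem Del8_mem (ih _ (by omega) q hqh hqi)

/-- The invariant ring `ℂ[x,y]^{G₈}` is generated as a `ℂ`-algebra by `W₈` and `W₁₂`. -/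
theorem invariant_ring_G8_eq_adjoin_W8_W12 (f : MvPolynomial (Fin 2) ℂ) :
    (∀ M ∈ G8, matAct (M : Matrix (Fin 2) (Fin 2) ℂ) f = f) ↔
      f ∈ Algebra.adjoin ℂ ({W8, W12} : Set (MvPolynomial (Fin 2) ℂ)) := by
  constructor
  · intro h
    have hf : Inv8 f := ⟨h sigma1U (Subgroup.subset_closure (by simp)),
      h sigma2U (Subgroup.subset_closure (by simp))⟩
    rw [← sum_homogeneousComponent f]
    apply sum_mem
    intro n _
    apply main8 n _ (homogeneousComponent_isHomogeneous n f)
    exact ⟨by rw [← act8_comp, hf.1], by rw [← act8_comp, hf.2]⟩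
  · intro h
    exact inv_all8 f ((mem_invAlg8 _).1 (adjoin_le8 h))
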